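/- arXiv:2601.20071 — 2 statements merged into one kernel-verified Lean document; each statement's English description precedes it below -/
import Mathlib

section
/- Let S be a measurable space, (Ω, ρ) a probability space, and p ≥ 1. Let g : S × Ω → S, b : S × Ω → ℝ^d, and A : S × Ω → ℝ^{d×d} be measurable, and suppose there is K ≥ 0 with ‖A(s,ω)‖_op ≤ K for all (s,ω). For a measurable family η : S → P(ℝ^d) of probability measures with finite p-th moments, define the operator (Tη)(s) = ∫_Ω (x ↦ b(s,ω) + A(s,ω)x)_# η(g(s,ω)) ρ(dω) (a mixture of affine pushforwards). Then for any two such families η₁, η₂ with sup_{s∈S} W_p(η₁(s), η₂(s)) finite, sup_{s∈S} W_p((Tη₁)(s), (Tη₂)(s)) ≤ K · sup_{s∈S} W_p(η₁(s), η₂(s)). -/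
open MeasureTheory

/-- The `p`-Wasserstein distance between two measures on a metric space:
the infimum over couplings `π` of `(∫ dist(x,y)^p dπ)^(1/p)`. -/
noncomputable def wassersteinDist {X : Type*} [MeasurableSpace X] [PseudoMetricSpace X]
    (p : ℝ) (μ ν : Measure X) : ℝ :=
  sInf { r : ℝ | ∃ π : Measure (X × X),
    π.map Prod.fst = μ ∧ π.map Prod.snd = ν ∧
    r = (∫ z : X × X, dist z.1 z.2 ^ p ∂π) ^ (1 / p) }

/-- The spectral norm (`ℓ² → ℓ²` operator norm) of a real matrix. -/
noncomputable def specNorm {m n : Type*} [Fintype m] [Fintype n] [DecidableEq n]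
    (A : Matrix m n ℝ) : ℝ :=
  ‖LinearMap.toContinuousLinearMap (Matrix.toEuclideanLin A)‖

/-- The abstract (complete Sobolev) distributional Bellman operator:
`(Tη)(s) = ∫_Ω (x ↦ b(s,ω) + A(s,ω)x)_# η(g(s,ω)) ρ(dω)`,
a mixture of affine pushforwards. -/
noncomputable def affineMixtureOp {S : Type*} [MeasurableSpace S] {d : ℕ}
    {Ω : Type*} [MeasurableSpace Ω] (ρ : Measure Ω)
    (g : S × Ω → S) (b : S × Ω → EuclideanSpace ℝ (Fin d))
    (A : S × Ω → Matrix (Fin d) (Fin d) ℝ)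
    (η : S → Measure (EuclideanSpace ℝ (Fin d))) :
    S → Measure (EuclideanSpace ℝ (Fin d)) :=
  fun s => ρ.bind fun ω =>
    (η (g (s, ω))).map fun x => b (s, ω) + Matrix.toEuclideanLin (A (s, ω)) x

open scoped ENNReal

section Completion

variable {X Y : Type*} [MeasurableSpace X] [MeasurableSpace Y]

/-- Adds to a sub-coupling density `w` with respect to `μ.prod ν` the normalized product of the
missing marginal densities, so that the sum is the density of a coupling of `μ` and `ν`. -/
noncomputable def completionDensity (μ : Measure X) (ν : Measure Y) (w : X × Y → ℝ≥0∞)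
    (z : X × Y) : ℝ≥0∞ :=
  w z + (1 - ∫⁻ y, w (z.1, y) ∂ν) * (1 - ∫⁻ x, w (x, z.2) ∂μ) /
    (1 - ∫⁻ x, ∫⁻ y, w (x, y) ∂ν ∂μ)

lemma map_fst_withDensity_prod {μ : Measure X} {ν : Measure Y} [SFinite μ] [SFinite ν]
    {h : X × Y → ℝ≥0∞} (hh : Measurable h)
    (h1 : ∀ᵐ x ∂μ, ∫⁻ y, h (x, y) ∂ν = 1) :
    ((μ.prod ν).withDensity h).map Prod.fst = μ := by
  refine Measure.ext_of_lintegral _ fun f hf => ?_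
  rw [lintegral_map hf measurable_fst,
    lintegral_withDensity_eq_lintegral_mul _ hh (by fun_prop), lintegral_prod _ (by fun_prop)]
  refine lintegral_congr_ae ?_
  filter_upwards [h1] with x hx
  simp only [Pi.mul_apply]
  rw [lintegral_mul_const _ (by fun_prop), hx, one_mul]

variable {μ : Measure X} {ν : Measure Y} [IsProbabilityMeasure μ] [IsProbabilityMeasure ν]
  {w : X × Y → ℝ≥0∞}

lemma measurable_completionDensity (hw : Measurable w) : Measurable (completionDensity μ ν w) := by
  have h₁ : Measurable fun x => ∫⁻ y, w (x, y) ∂ν := hw.lintegral_prod_right'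
  have h₂ : Measurable fun y => ∫⁻ x, w (x, y) ∂μ := hw.lintegral_prod_left'
  unfold completionDensity
  fun_prop

lemma lintegral_one_sub (hw : Measurable w)
    (hr : ∀ x, ∫⁻ y, w (x, y) ∂ν ≤ 1) :
    ∫⁻ x, (1 - ∫⁻ y, w (x, y) ∂ν) ∂μ = 1 - ∫⁻ x, ∫⁻ y, w (x, y) ∂ν ∂μ := by
  have h₁ : Measurable fun x => ∫⁻ y, w (x, y) ∂ν := hw.lintegral_prod_right'
  have h : ∫⁻ x, ∫⁻ y, w (x, y) ∂ν ∂μ ≤ 1 := by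
    calc _ ≤ ∫⁻ _, 1 ∂μ := lintegral_mono hr
      _ = 1 := by simp
  rw [lintegral_sub h₁ (h.trans_lt ENNReal.one_lt_top).ne (ae_of_all _ hr)]
  simp

lemma completionDensity_swap (hw : Measurable w) (z : Y × X) :
    completionDensity ν μ (w ∘ Prod.swap) z = completionDensity μ ν w z.swap := by
  simp only [completionDensity, Function.comp_apply, Prod.swap_prod_mk, Prod.fst_swap,
    Prod.snd_swap]
  rw [lintegral_lintegral_swap (f := fun y x => w (x, y)) (hw.comp measurable_swap).aemeasurable,
    mul_comm (1 - ∫⁻ _, _ ∂μ)]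

lemma lintegral_completionDensity_right (hw : Measurable w)
    (hr : ∀ x, ∫⁻ y, w (x, y) ∂ν ≤ 1) (hc : ∀ y, ∫⁻ x, w (x, y) ∂μ ≤ 1) :
    ∀ᵐ x ∂μ, ∫⁻ y, completionDensity μ ν w (x, y) ∂ν = 1 := by
  have h₁ : Measurable fun x => ∫⁻ y, w (x, y) ∂ν := hw.lintegral_prod_right'
  have h₂ : Measurable fun y => ∫⁻ x, w (x, y) ∂μ := hw.lintegral_prod_left'
  have hu := lintegral_one_sub (μ := μ) hw hr
  have hv : ∫⁻ y, (1 - ∫⁻ x, w (x, y) ∂μ) ∂ν = 1 - ∫⁻ x, ∫⁻ y, w (x, y) ∂ν ∂μ := by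
    rw [lintegral_lintegral_swap (f := fun x y => w (x, y)) hw.aemeasurable]
    exact lintegral_one_sub (w := w ∘ Prod.swap) (hw.comp measurable_swap) hc
  set m := 1 - ∫⁻ x, ∫⁻ y, w (x, y) ∂ν ∂μ with hm
  have key : ∀ x, ∫⁻ y, completionDensity μ ν w (x, y) ∂ν
      = ∫⁻ y, w (x, y) ∂ν + (1 - ∫⁻ y, w (x, y) ∂ν) * (m / m) := by
    intro x
    simp only [completionDensity, ← hm]
    rw [lintegral_add_left (by fun_prop)]
    simp_rw [mul_div_assoc]
    rw [lintegral_const_mul _ (by fun_prop)]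
    simp_rw [div_eq_mul_inv]
    rw [lintegral_mul_const _ (by fun_prop), hv]
  have hmt : m ≠ ∞ := (tsub_le_self.trans_lt ENNReal.one_lt_top).ne
  by_cases h0 : m = 0
  · rw [h0, lintegral_eq_zero_iff (by fun_prop)] at hu
    filter_upwards [hu] with x hx
    rw [key, h0, ENNReal.zero_div, mul_zero, add_zero]
    exact le_antisymm (hr x) (tsub_eq_zero_iff_le.1 hx)
  · refine ae_of_all _ fun x => ?_
    rw [key, ENNReal.div_self h0 hmt, mul_one, add_tsub_cancel_of_le (hr x)]

lemma map_fst_completion (hw : Measurable w)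
    (hr : ∀ x, ∫⁻ y, w (x, y) ∂ν ≤ 1) (hc : ∀ y, ∫⁻ x, w (x, y) ∂μ ≤ 1) :
    ((μ.prod ν).withDensity (completionDensity μ ν w)).map Prod.fst = μ :=
  map_fst_withDensity_prod (measurable_completionDensity hw)
    (lintegral_completionDensity_right hw hr hc)

lemma map_snd_completion (hw : Measurable w)
    (hr : ∀ x, ∫⁻ y, w (x, y) ∂ν ≤ 1) (hc : ∀ y, ∫⁻ x, w (x, y) ∂μ ≤ 1) :
    ((μ.prod ν).withDensity (completionDensity μ ν w)).map Prod.snd = ν := by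
  have hm := measurable_completionDensity (μ := μ) (ν := ν) hw
  refine Eq.trans ?_ (map_fst_completion (μ := ν) (ν := μ) (w := w ∘ Prod.swap)
    (hw.comp measurable_swap) hc hr)
  refine Measure.ext_of_lintegral _ fun f hf => ?_
  rw [lintegral_map hf measurable_fst, lintegral_map hf measurable_snd,
    lintegral_withDensity_eq_lintegral_mul _ hm (by fun_prop),
    lintegral_withDensity_eq_lintegral_mul _
      (measurable_completionDensity (hw.comp measurable_swap)) (by fun_prop),
    lintegral_prod_symm _ (by fun_prop), lintegral_prod]
  · simp [completionDensity_swap hw]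
  · exact ((measurable_completionDensity (hw.comp measurable_swap)).mul
      (hf.comp measurable_fst)).aemeasurable

/-- The mass added by the completion costs at most what the missing marginals cost. -/
lemma lintegral_completion_le (hw : Measurable w)
    (hr : ∀ x, ∫⁻ y, w (x, y) ∂ν ≤ 1) (hc : ∀ y, ∫⁻ x, w (x, y) ∂μ ≤ 1)
    {c : X × Y → ℝ≥0∞} (hcm : Measurable c) {φ : X → ℝ≥0∞} {ψ : Y → ℝ≥0∞}
    (hφ : Measurable φ) (hψ : Measurable ψ) (hle : ∀ x y, c (x, y) ≤ φ x + ψ y) :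
    ∫⁻ z, c z ∂((μ.prod ν).withDensity (completionDensity μ ν w)) ≤
      ∫⁻ z, w z * c z ∂(μ.prod ν) + (∫⁻ x, φ x * (1 - ∫⁻ y, w (x, y) ∂ν) ∂μ +
        ∫⁻ y, ψ y * (1 - ∫⁻ x, w (x, y) ∂μ) ∂ν) := by
  have h₁ : Measurable fun x => ∫⁻ y, w (x, y) ∂ν := hw.lintegral_prod_right'
  have h₂ : Measurable fun y => ∫⁻ x, w (x, y) ∂μ := hw.lintegral_prod_left'
  have hu := lintegral_one_sub (μ := μ) hw hr
  have hv : ∫⁻ y, (1 - ∫⁻ x, w (x, y) ∂μ) ∂ν = 1 - ∫⁻ x, ∫⁻ y, w (x, y) ∂ν ∂μ := by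
    rw [lintegral_lintegral_swap (f := fun x y => w (x, y)) hw.aemeasurable]
    exact lintegral_one_sub (w := w ∘ Prod.swap) (hw.comp measurable_swap) hc
  have hh := measurable_completionDensity (μ := μ) (ν := ν) hw
  rw [lintegral_withDensity_eq_lintegral_mul _ hh hcm]
  set m := 1 - ∫⁻ x, ∫⁻ y, w (x, y) ∂ν ∂μ with hm
  set u : X → ℝ≥0∞ := fun x => 1 - ∫⁻ y, w (x, y) ∂ν with hu'
  set v : Y → ℝ≥0∞ := fun y => 1 - ∫⁻ x, w (x, y) ∂μ with hv'
  have hum : Measurable u := by fun_prop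
  have hvm : Measurable v := by fun_prop
  calc ∫⁻ z, (completionDensity μ ν w * c) z ∂(μ.prod ν)
      ≤ ∫⁻ z, (w z * c z + (m⁻¹ * ((φ z.1 * u z.1) * v z.2)
          + m⁻¹ * (u z.1 * (ψ z.2 * v z.2)))) ∂(μ.prod ν) := by
        refine lintegral_mono fun z => ?_
        simp only [Pi.mul_apply, completionDensity, add_mul]
        gcongr
        calc _ ≤ (u z.1 * v z.2 / m) * (φ z.1 + ψ z.2) := by
              gcongr; exact hle z.1 z.2
          _ = _ := by rw [div_eq_mul_inv]; ring
    _ = ∫⁻ z, w z * c z ∂(μ.prod ν) + (m⁻¹ * ((∫⁻ x, φ x * u x ∂μ) * m)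
          + m⁻¹ * (m * ∫⁻ y, ψ y * v y ∂ν)) := by
        rw [lintegral_add_left (by fun_prop), lintegral_add_left (by fun_prop),
          lintegral_const_mul _ (by fun_prop), lintegral_const_mul _ (by fun_prop),
          lintegral_prod_mul (f := fun x => φ x * u x) (by fun_prop) (by fun_prop),
          lintegral_prod_mul (g := fun x => ψ x * v x) (by fun_prop) (by fun_prop), hu, hv]
    _ = ∫⁻ z, w z * c z ∂(μ.prod ν) + ((∫⁻ x, φ x * u x ∂μ) * (m / m)
          + (∫⁻ y, ψ y * v y ∂ν) * (m / m)) := by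
        rw [div_eq_mul_inv]; ring
    _ ≤ _ := by
        gcongr <;> exact mul_le_of_le_one_right' ENNReal.div_self_le_one

end Completion

section Quantization

open Filter Topology

lemma exists_measurable_quantization {X : Type*} [PseudoMetricSpace X] [Nonempty X]
    [TopologicalSpace.SeparableSpace X] [MeasurableSpace X] [OpensMeasurableSpace X]
    {δ : ℝ≥0∞} (hδ : 0 < δ) :
    ∃ (q : X → ℕ) (e : ℕ → X), Measurable q ∧ ∀ x, edist x (e (q x)) ≤ δ := by
  classical
  let e := TopologicalSpace.denseSeq X
  have h : ∀ x, ∃ n, edist x (e n) < δ := fun x => by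
    obtain ⟨_, ⟨n, rfl⟩, hn⟩ :=
      EMetric.mem_closure_iff.1 (TopologicalSpace.denseRange_denseSeq X x) δ hδ
    exact ⟨n, hn⟩
  refine ⟨fun x => Nat.find (h x), e, measurable_find h fun n => ?_, fun x =>
    (Nat.find_spec (h x)).le⟩
  exact (isOpen_lt (by fun_prop) continuous_const).measurableSet

variable {X Y : Type*} [MeasurableSpace X] [MeasurableSpace Y]

/-- The weight `f kl / n` attached to the pair of cells indexed by `kl`. -/
noncomputable def gridWeight (i : ℕ × (ℕ × ℕ →₀ ℕ)) (kl : ℕ × ℕ) : ℝ≥0∞ :=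
  (i.2 kl : ℝ≥0∞) / (i.1 : ℝ≥0∞)

/-- The step function with value `gridWeight i (k, l)` on the product of the cells `{q = k}` and
`{r = l}`. -/
noncomputable def cellWeight (q : X → ℕ) (r : Y → ℕ) (i : ℕ × (ℕ × ℕ →₀ ℕ)) (z : X × Y) : ℝ≥0∞ :=
  gridWeight i (q z.1, r z.2)

lemma measurable_cellWeight {q : X → ℕ} {r : Y → ℕ} (hq : Measurable q) (hr : Measurable r)
    (i : ℕ × (ℕ × ℕ →₀ ℕ)) : Measurable (cellWeight q r i) :=
  (Measurable.of_discrete (f := gridWeight i)).comp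
    ((hq.comp measurable_fst).prodMk (hr.comp measurable_snd))

/-- The density with respect to `μ.prod ν` of the coupling obtained from `π` by resampling
independently within the cells. -/
noncomputable def cellDensity (π : Measure (X × Y)) (q : X → ℕ) (r : Y → ℕ) (kl : ℕ × ℕ) : ℝ≥0∞ :=
  π {z | q z.1 = kl.1 ∧ r z.2 = kl.2} /
    (π {z | q z.1 = kl.1} * π {z | r z.2 = kl.2})

variable {π : Measure (X × Y)} [IsProbabilityMeasure π] {q : X → ℕ} {r : Y → ℕ}

lemma cellDensity_ne_top (kl : ℕ × ℕ) : cellDensity π q r kl ≠ ∞ := by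
  unfold cellDensity
  by_cases h1 : π {z | q z.1 = kl.1} = 0
  · simp [measure_mono_null (fun z hz => hz.1 : {z : X × Y | q z.1 = kl.1 ∧ r z.2 = kl.2} ⊆ _) h1]
  by_cases h2 : π {z | r z.2 = kl.2} = 0
  · simp [measure_mono_null (fun z hz => hz.2 : {z : X × Y | q z.1 = kl.1 ∧ r z.2 = kl.2} ⊆ _) h2]
  exact ENNReal.div_ne_top (measure_ne_top _ _) (mul_ne_zero h1 h2)

lemma cellDensity_swap (π : Measure (X × Y)) (k l : ℕ) :
    cellDensity (π.map Prod.swap) r q (k, l) = cellDensity π q r (l, k) := by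
  have (s : Set (Y × X)) : π.map Prod.swap s = π (Prod.swap ⁻¹' s) :=
    MeasurableEquiv.prodComm.map_apply s
  simp only [cellDensity, this, Set.preimage_ofPred_eq, Prod.fst_swap, Prod.snd_swap]
  rw [mul_comm, Set.ofPred_and, Set.ofPred_and, Set.inter_comm]

lemma cellDensity_mul (k l : ℕ) :
    cellDensity π q r (k, l) * π {z | r z.2 = l} =
      π {z | q z.1 = k ∧ r z.2 = l} / π {z | q z.1 = k} := by
  unfold cellDensity
  by_cases h2 : π {z | r z.2 = l} = 0
  · simp [measure_mono_null (fun z hz => hz.2 : {z : X × Y | q z.1 = k ∧ r z.2 = l} ⊆ _) h2]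
  · simp only [div_eq_mul_inv]
    rw [ENNReal.mul_inv (.inr (measure_ne_top _ _)) (.inr h2), mul_assoc, mul_assoc,
      ENNReal.inv_mul_cancel h2 (measure_ne_top _ _), mul_one]

lemma lintegral_comp_eq_tsum (hr : Measurable r) (ν : Measure Y) (f : ℕ → ℝ≥0∞) :
    ∫⁻ y, f (r y) ∂ν = ∑' l, f l * ν {y | r y = l} := by
  rw [← lintegral_map (Measurable.of_discrete (f := f)) hr, lintegral_countable']
  congr with l
  rw [Measure.map_apply hr (measurableSet_singleton l)]
  rfl

lemma lintegral_cellDensity (hq : Measurable q) (hr : Measurable r) {ν : Measure Y}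
    (hν : π.map Prod.snd = ν) (k : ℕ) :
    ∫⁻ y, cellDensity π q r (k, r y) ∂ν = π {z | q z.1 = k} / π {z | q z.1 = k} := by
  subst hν
  rw [lintegral_comp_eq_tsum hr _ fun l => cellDensity π q r (k, l)]
  have h1 (l : ℕ) : π.map Prod.snd {y | r y = l} = π {z | r z.2 = l} :=
    Measure.map_apply measurable_snd (hr (measurableSet_singleton l))
  simp_rw [h1, cellDensity_mul, div_eq_mul_inv]
  rw [ENNReal.tsum_mul_right]
  congr 1
  rw [← measure_iUnion]
  · congr 1; ext z; simp
  · intro a b hab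
    refine Set.disjoint_left.2 fun z hz hz' => hab (hz.2.symm.trans hz'.2)
  · intro l
    exact ((hq.comp measurable_fst) (measurableSet_singleton k)).inter
      ((hr.comp measurable_snd) (measurableSet_singleton l))

lemma lintegral_cellDensity_le (hq : Measurable q) (hr : Measurable r) {ν : Measure Y}
    (hν : π.map Prod.snd = ν) (k : ℕ) : ∫⁻ y, cellDensity π q r (k, r y) ∂ν ≤ 1 := by
  rw [lintegral_cellDensity hq hr hν]
  exact ENNReal.div_self_le_one

lemma lintegral_cellDensity_ae (hq : Measurable q) (hr : Measurable r) {μ : Measure X}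
    {ν : Measure Y} (hμ : π.map Prod.fst = μ) (hν : π.map Prod.snd = ν) :
    ∀ᵐ x ∂μ, ∫⁻ y, cellDensity π q r (q x, r y) ∂ν = 1 := by
  have h : ∀ᵐ k ∂(μ.map q), ∫⁻ y, cellDensity π q r (k, r y) ∂ν = 1 := by
    rw [ae_iff_of_countable]
    intro k hk
    rw [Measure.map_apply hq (measurableSet_singleton k), ← hμ,
      Measure.map_apply measurable_fst (hq (measurableSet_singleton k))] at hk
    rw [lintegral_cellDensity hq hr hν]
    exact ENNReal.div_self hk (measure_ne_top _ _)
  exact ae_of_ae_map hq.aemeasurable h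

/-- A function of the cells costs no more after resampling. -/
lemma lintegral_cellDensity_mul_le (hq : Measurable q) (hr : Measurable r) {μ : Measure X}
    {ν : Measure Y} (hμ : π.map Prod.fst = μ) (hν : π.map Prod.snd = ν) (G : ℕ × ℕ → ℝ≥0∞) :
    ∫⁻ z, cellDensity π q r (q z.1, r z.2) * G (q z.1, r z.2) ∂(μ.prod ν) ≤
      ∫⁻ z, G (q z.1, r z.2) ∂π := by
  have : IsProbabilityMeasure μ := hμ ▸ Measure.isProbabilityMeasure_map (by fun_prop)
  have : IsProbabilityMeasure ν := hν ▸ Measure.isProbabilityMeasure_map (by fun_prop)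
  have hqr : Measurable (Prod.map q r) := hq.prodMap hr
  have hG : Measurable G := Measurable.of_discrete
  have hDG : Measurable fun kl => cellDensity π q r kl * G kl := Measurable.of_discrete
  have e1 := lintegral_map (μ := μ.prod ν) hDG hqr
  have e2 := lintegral_map (μ := π) hG hqr
  simp only [Prod.map] at e1 e2
  rw [← e1, ← e2, lintegral_countable', lintegral_countable']
  refine ENNReal.tsum_le_tsum fun ⟨k, l⟩ => ?_
  have hset : Prod.map q r ⁻¹' {(k, l)} = (q ⁻¹' {k}) ×ˢ (r ⁻¹' {l}) := by
    ext; simp [Prod.map]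
  have h3 : π.map (Prod.map q r) {(k, l)} = π {z | q z.1 = k ∧ r z.2 = l} := by
    rw [Measure.map_apply hqr (measurableSet_singleton _), hset]
    rfl
  have h4 : (μ.prod ν).map (Prod.map q r) {(k, l)} = π {z | q z.1 = k} * π {z | r z.2 = l} := by
    rw [Measure.map_apply hqr (measurableSet_singleton _), hset, Measure.prod_prod, ← hμ, ← hν,
      Measure.map_apply measurable_fst (hq (measurableSet_singleton k)),
      Measure.map_apply measurable_snd (hr (measurableSet_singleton l))]
    rfl
  change _ * (μ.prod ν).map (Prod.map q r) {(k, l)} ≤ _ * π.map (Prod.map q r) {(k, l)}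
  rw [h3, h4]
  calc _ = G (k, l) * (π {z | q z.1 = k ∧ r z.2 = l} / π {z | q z.1 = k} * π {z | q z.1 = k}) := by
        rw [← cellDensity_mul]; ring
    _ ≤ _ := by gcongr; rw [mul_comm]; exact ENNReal.mul_div_le

lemma exists_gridWeight_tendsto (π : Measure (X × Y)) [IsProbabilityMeasure π]
    (q : X → ℕ) (r : Y → ℕ) :
    ∃ i : ℕ → ℕ × (ℕ × ℕ →₀ ℕ), ∀ kl,
      (∀ n, gridWeight (i n) kl ≤ cellDensity π q r kl) ∧
      Tendsto (fun n => gridWeight (i n) kl) atTop (𝓝 (cellDensity π q r kl)) := by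
  classical
  let D : ℕ × ℕ → NNReal := fun kl => (cellDensity π q r kl).toNNReal
  let F : ℕ → Finset (ℕ × ℕ) := fun n => Finset.range n ×ˢ Finset.range n
  let f : ℕ → (ℕ × ℕ →₀ ℕ) := fun n =>
    Finsupp.onFinset (F n) (fun kl => if kl ∈ F n then ⌊D kl * n⌋₊ else 0) (by
      intro kl h; by_contra h'; simp [h'] at h)
  refine ⟨fun n => (n, f n), fun kl => ?_⟩
  have hD : cellDensity π q r kl = (D kl : ℝ≥0∞) :=
    (ENNReal.coe_toNNReal (cellDensity_ne_top _)).symm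
  rw [hD]
  have hw (n : ℕ) (hn : n ≠ 0) : gridWeight (n, f n) kl =
      (((if kl ∈ F n then ⌊D kl * n⌋₊ else 0 : ℕ) / n : NNReal) : ℝ≥0∞) := by
    rw [ENNReal.coe_div (by exact_mod_cast hn)]
    simp only [gridWeight, f, Finsupp.onFinset_apply]
    split_ifs <;> simp
  constructor
  · intro n
    rcases eq_or_ne n 0 with rfl | hn
    · simp [gridWeight, f, F]
    rw [hw n hn, ENNReal.coe_le_coe, div_le_iff₀ (by positivity)]
    split_ifs
    · exact Nat.floor_le (by positivity)
    · simp
  · have h : Tendsto (fun n : ℕ => (⌊D kl * n⌋₊ : NNReal) / n) atTop (𝓝 (D kl)) := by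
      rw [← NNReal.tendsto_coe]
      refine ((tendsto_nat_floor_mul_div_atTop (R := ℝ) (a := D kl) (D kl).coe_nonneg).comp
        tendsto_natCast_atTop_atTop).congr fun n => ?_
      have := Nonneg.nat_floor_coe (D kl * n : NNReal)
      simp only [NNReal.val_eq_coe, NNReal.coe_mul, NNReal.coe_natCast] at this
      simp [this]
      rfl
    refine (ENNReal.tendsto_coe.2 h).congr' ?_
    filter_upwards [eventually_gt_atTop (max kl.1 kl.2)] with n hn
    rw [hw n (by omega), if_pos (by simp [F]; omega)]

end Quantization

section Selection

open Filter Topology ProbabilityTheory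

variable {X Y : Type*} [MeasurableSpace X] [MeasurableSpace Y]

lemma tendsto_lintegral_mul_one_sub {μ : Measure X} {ν : Measure Y} [SFinite ν]
    {w : ℕ → X × Y → ℝ≥0∞} {D : X × Y → ℝ≥0∞} (hw : ∀ n, Measurable (w n))
    (hle : ∀ n z, w n z ≤ D z) (hlim : ∀ z, Tendsto (fun n => w n z) atTop (𝓝 (D z)))
    (hD1 : ∀ᵐ x ∂μ, ∫⁻ y, D (x, y) ∂ν = 1)
    {φ : X → ℝ≥0∞} (hφ : Measurable φ) (hφi : ∫⁻ x, φ x ∂μ ≠ ∞) :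
    Tendsto (fun n => ∫⁻ x, φ x * (1 - ∫⁻ y, w n (x, y) ∂ν) ∂μ) atTop (𝓝 0) := by
  have hm (n : ℕ) : Measurable fun x => ∫⁻ y, w n (x, y) ∂ν := (hw n).lintegral_prod_right'
  rw [← lintegral_zero (μ := μ)]
  refine tendsto_lintegral_of_dominated_convergence φ (fun n => by fun_prop)
    (fun n => ae_of_all _ fun x => mul_le_of_le_one_right' tsub_le_self) hφi ?_
  filter_upwards [hD1, ae_lt_top hφ hφi] with x hx hφx
  have h1 : Tendsto (fun n => ∫⁻ y, w n (x, y) ∂ν) atTop (𝓝 (∫⁻ y, D (x, y) ∂ν)) :=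
    tendsto_lintegral_of_dominated_convergence (fun y => D (x, y))
      (fun n => (hw n).comp measurable_prodMk_left) (fun n => ae_of_all _ fun y => hle n _)
      (by simp [hx]) (ae_of_all _ fun y => hlim _)
  have h2 := ENNReal.Tendsto.const_mul (a := φ x)
    (ENNReal.Tendsto.sub (tendsto_const_nhds (x := (1 : ℝ≥0∞))) h1 (.inl ENNReal.one_ne_top))
    (.inr hφx.ne)
  simpa [hx] using h2

/-- The weight `cellWeight q r i` is a sub-coupling of `μ` and `ν` whose completion costs less
than `B`. -/
def IsGoodWeight (q : X → ℕ) (r : Y → ℕ) (c : X × Y → ℝ≥0∞) (B : ℝ≥0∞)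
    (μ : Measure X) (ν : Measure Y) (i : ℕ × (ℕ × ℕ →₀ ℕ)) : Prop :=
  (∀ k, ∫⁻ y, gridWeight i (k, r y) ∂ν ≤ 1) ∧
  (∀ l, ∫⁻ x, gridWeight i (q x, l) ∂μ ≤ 1) ∧
  ∫⁻ z, completionDensity μ ν (cellWeight q r i) z * c z ∂(μ.prod ν) < B

lemma exists_isGoodWeight {π : Measure (X × Y)} [IsProbabilityMeasure π] {μ : Measure X}
    {ν : Measure Y} (hμ : π.map Prod.fst = μ) (hν : π.map Prod.snd = ν)
    {q : X → ℕ} {r : Y → ℕ} (hq : Measurable q) (hr : Measurable r)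
    {c : X × Y → ℝ≥0∞} (hc : Measurable c) {φ : X → ℝ≥0∞} {ψ : Y → ℝ≥0∞}
    (hφ : Measurable φ) (hψ : Measurable ψ) (hle : ∀ x y, c (x, y) ≤ φ x + ψ y)
    (hφi : ∫⁻ x, φ x ∂μ ≠ ∞) (hψi : ∫⁻ y, ψ y ∂ν ≠ ∞)
    {G : ℕ × ℕ → ℝ≥0∞} (hG : ∀ z, c z ≤ G (q z.1, r z.2)) {B : ℝ≥0∞}
    (hB : ∫⁻ z, G (q z.1, r z.2) ∂π < B) :
    ∃ i, IsGoodWeight q r c B μ ν i := by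
  have : IsProbabilityMeasure μ := hμ ▸ Measure.isProbabilityMeasure_map (by fun_prop)
  have : IsProbabilityMeasure ν := hν ▸ Measure.isProbabilityMeasure_map (by fun_prop)
  have : IsProbabilityMeasure (π.map Prod.swap) :=
    Measure.isProbabilityMeasure_map (by fun_prop)
  have hμ' : (π.map Prod.swap).map Prod.snd = μ := by
    rw [Measure.map_map measurable_snd measurable_swap]; exact hμ
  have hν' : (π.map Prod.swap).map Prod.fst = ν := by
    rw [Measure.map_map measurable_fst measurable_swap]; exact hν
  obtain ⟨i, hi⟩ := exists_gridWeight_tendsto π q r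
  have hwm (n : ℕ) : Measurable (cellWeight q r (i n)) := measurable_cellWeight hq hr _
  have hDx (k : ℕ) := lintegral_cellDensity_le (π := π) hq hr hν k
  have hDy (l : ℕ) : ∫⁻ x, cellDensity π q r (q x, l) ∂μ ≤ 1 := by
    simpa only [cellDensity_swap] using lintegral_cellDensity_le hr hq hμ' l
  have hrow (n : ℕ) (k : ℕ) : ∫⁻ y, gridWeight (i n) (k, r y) ∂ν ≤ 1 :=
    (lintegral_mono fun y => (hi (k, r y)).1 n).trans (hDx k)
  have hcol (n : ℕ) (l : ℕ) : ∫⁻ x, gridWeight (i n) (q x, l) ∂μ ≤ 1 :=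
    (lintegral_mono fun x => (hi (q x, l)).1 n).trans (hDy l)
  have hα := tendsto_lintegral_mul_one_sub (μ := μ) (ν := ν)
    (D := fun z => cellDensity π q r (q z.1, r z.2)) hwm
    (fun n z => (hi _).1 n)
    (fun z => (hi _).2) (lintegral_cellDensity_ae hq hr hμ hν) hφ hφi
  have hβ := tendsto_lintegral_mul_one_sub (μ := ν) (ν := μ)
    (w := fun n => cellWeight q r (i n) ∘ Prod.swap)
    (D := fun z : Y × X => cellDensity π q r (q z.2, r z.1))
    (fun n => (hwm n).comp measurable_swap) (fun n z => (hi _).1 n)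
    (fun z => (hi _).2)
    (by simpa only [cellDensity_swap] using lintegral_cellDensity_ae hr hq hν' hμ') hψ hψi
  have hlim := (hα.add hβ).const_add (∫⁻ z, G (q z.1, r z.2) ∂π)
  rw [add_zero, add_zero] at hlim
  obtain ⟨n, hn⟩ := (hlim.eventually (gt_mem_nhds hB)).exists
  refine ⟨i n, hrow n, hcol n, lt_of_le_of_lt ?_ hn⟩
  have hcm := measurable_completionDensity (μ := μ) (ν := ν) (hwm n)
  have h := lintegral_completion_le (μ := μ) (ν := ν) (hwm n) (fun x => hrow n (q x))
    (fun y => hcol n (r y)) hc hφ hψ hle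
  rw [lintegral_withDensity_eq_lintegral_mul _ hcm hc] at h
  refine h.trans (add_le_add (le_trans (lintegral_mono fun z => ?_)
    (lintegral_cellDensity_mul_le hq hr hμ hν G)) le_rfl)
  exact mul_le_mul' ((hi _).1 n) (hG z)

end Selection

section KernelCoupling

open Filter Topology ProbabilityTheory

variable {Ω X Y : Type*} [MeasurableSpace Ω] [MeasurableSpace X] [MeasurableSpace Y]

lemma measurable_uncurry_completionDensity (κ₁ : Kernel Ω X) (κ₂ : Kernel Ω Y)
    [IsMarkovKernel κ₁] [IsMarkovKernel κ₂] {w : X × Y → ℝ≥0∞} (hw : Measurable w) :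
    Measurable (Function.uncurry fun ω => completionDensity (κ₁ ω) (κ₂ ω) w) := by
  have h1 : Measurable fun a : Ω × (X × Y) => ∫⁻ y, w (a.2.1, y) ∂(κ₂ a.1) :=
    Measurable.lintegral_kernel_prod_right' (κ := κ₂.comap Prod.fst measurable_fst)
      (f := fun b : (Ω × (X × Y)) × Y => w (b.1.2.1, b.2)) (by fun_prop)
  have h2 : Measurable fun a : Ω × (X × Y) => ∫⁻ x, w (x, a.2.2) ∂(κ₁ a.1) :=
    Measurable.lintegral_kernel_prod_right' (κ := κ₁.comap Prod.fst measurable_fst)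
      (f := fun b : (Ω × (X × Y)) × X => w (b.2, b.1.2.2)) (by fun_prop)
  have h4 : Measurable fun a : Ω × X => ∫⁻ y, w (a.2, y) ∂(κ₂ a.1) :=
    Measurable.lintegral_kernel_prod_right' (κ := κ₂.comap Prod.fst measurable_fst)
      (f := fun b : (Ω × X) × Y => w (b.1.2, b.2)) (by fun_prop)
  have h3 : Measurable fun ω => ∫⁻ x, ∫⁻ y, w (x, y) ∂(κ₂ ω) ∂(κ₁ ω) :=
    Measurable.lintegral_kernel_prod_right' (κ := κ₁) h4
  exact (hw.comp measurable_snd).add (((measurable_const.sub h1).mul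
    (measurable_const.sub h2)).div (measurable_const.sub (h3.comp measurable_fst)))

lemma measurableSet_isGoodWeight (κ₁ : Kernel Ω X) (κ₂ : Kernel Ω Y)
    [IsMarkovKernel κ₁] [IsMarkovKernel κ₂] {q : X → ℕ} {r : Y → ℕ} (hq : Measurable q)
    (hr : Measurable r) {c : X × Y → ℝ≥0∞} (hc : Measurable c) (B : ℝ≥0∞)
    (i : ℕ × (ℕ × ℕ →₀ ℕ)) : MeasurableSet {ω | IsGoodWeight q r c B (κ₁ ω) (κ₂ ω) i} := by
  have hg : Measurable (gridWeight i) := .of_discrete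
  have h3 : Measurable fun ω =>
      ∫⁻ z, completionDensity (κ₁ ω) (κ₂ ω) (cellWeight q r i) z * c z ∂((κ₁ ω).prod (κ₂ ω)) := by
    simp_rw [← Kernel.prod_apply]
    exact Measurable.lintegral_kernel_prod_right' (κ := κ₁ ×ₖ κ₂)
      ((measurable_uncurry_completionDensity κ₁ κ₂ (measurable_cellWeight hq hr i)).mul
        (hc.comp measurable_snd))
  have hκ₁ (l : ℕ) : Measurable fun ω => ∫⁻ x, gridWeight i (q x, l) ∂(κ₁ ω) :=
    (Measure.measurable_lintegral (by fun_prop)).comp κ₁.measurable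
  have hκ₂ (k : ℕ) : Measurable fun ω => ∫⁻ y, gridWeight i (k, r y) ∂(κ₂ ω) :=
    (Measure.measurable_lintegral (by fun_prop)).comp κ₂.measurable
  refine measurableSet_setOfPred.2 (.and (.forall fun k => ?_) (.and (.forall fun l => ?_) ?_))
  · exact measurableSet_setOfPred.1 (measurableSet_le (hκ₂ k) measurable_const)
  · exact measurableSet_setOfPred.1 (measurableSet_le (hκ₁ l) measurable_const)
  · exact measurableSet_setOfPred.1 (measurableSet_lt h3 measurable_const)

/-- Measurable selection of couplings: if every pair `κ₁ ω`, `κ₂ ω` has a good weight, then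
couplings of cost less than `B` can be chosen as a kernel. -/
lemma exists_kernel_coupling (κ₁ : Kernel Ω X) (κ₂ : Kernel Ω Y)
    [IsMarkovKernel κ₁] [IsMarkovKernel κ₂] {q : X → ℕ} {r : Y → ℕ} (hq : Measurable q)
    (hr : Measurable r) {c : X × Y → ℝ≥0∞} (hc : Measurable c) {B : ℝ≥0∞}
    (h : ∀ ω, ∃ i, IsGoodWeight q r c B (κ₁ ω) (κ₂ ω) i) :
    ∃ π : Kernel Ω (X × Y), ∀ ω, (π ω).map Prod.fst = κ₁ ω ∧ (π ω).map Prod.snd = κ₂ ω ∧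
      ∫⁻ z, c z ∂(π ω) < B := by
  classical
  obtain ⟨enum, henum⟩ := exists_surjective_nat (ℕ × (ℕ × ℕ →₀ ℕ))
  have h' : ∀ ω, ∃ n, IsGoodWeight q r c B (κ₁ ω) (κ₂ ω) (enum n) := fun ω => by
    obtain ⟨i, hi⟩ := h ω
    obtain ⟨n, rfl⟩ := henum i
    exact ⟨n, hi⟩
  have hmeas (n : ℕ) := measurable_uncurry_completionDensity κ₁ κ₂
    (measurable_cellWeight hq hr (enum n))
  let P : ℕ → Kernel Ω (X × Y) := fun n => (κ₁ ×ₖ κ₂).withDensity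
    fun ω => completionDensity (κ₁ ω) (κ₂ ω) (cellWeight q r (enum n))
  refine ⟨⟨fun ω => P (Nat.find (h' ω)) ω, Measurable.find (fun n => (P n).measurable)
    (fun n => measurableSet_isGoodWeight κ₁ κ₂ hq hr hc B (enum n)) h'⟩, fun ω => ?_⟩
  obtain ⟨h1, h2, h3⟩ := Nat.find_spec (h' ω)
  change (P (Nat.find (h' ω)) ω).map Prod.fst = _ ∧ (P (Nat.find (h' ω)) ω).map Prod.snd = _ ∧
    ∫⁻ z, c z ∂(P (Nat.find (h' ω)) ω) < B
  set n := Nat.find (h' ω)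
  have hw := measurable_cellWeight hq hr (enum n)
  simp only [P, Kernel.withDensity_apply _ (hmeas n), Kernel.prod_apply]
  refine ⟨map_fst_completion hw (fun x => h1 (q x)) (fun y => h2 (r y)),
    map_snd_completion hw (fun x => h1 (q x)) (fun y => h2 (r y)), ?_⟩
  rwa [lintegral_withDensity_eq_lintegral_mul _ (measurable_completionDensity hw) hc]

lemma exists_kernel_coupling_edist {X : Type*} [PseudoMetricSpace X] [SecondCountableTopology X]
    [MeasurableSpace X] [BorelSpace X] {p : ℝ} (hp : 1 ≤ p) (x₀ : X) (κ₁ κ₂ : Kernel Ω X)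
    [IsMarkovKernel κ₁] [IsMarkovKernel κ₂]
    (h₁ : ∀ ω, ∫⁻ x, edist x x₀ ^ p ∂(κ₁ ω) ≠ ∞) (h₂ : ∀ ω, ∫⁻ x, edist x x₀ ^ p ∂(κ₂ ω) ≠ ∞)
    {R R' : ℝ≥0∞} (hR : R < R')
    (h : ∀ ω, ∃ π : Measure (X × X), π.map Prod.fst = κ₁ ω ∧ π.map Prod.snd = κ₂ ω ∧
      ∫⁻ z, edist z.1 z.2 ^ p ∂π ≤ R ^ p) :
    ∃ π : Kernel Ω (X × X), ∀ ω, (π ω).map Prod.fst = κ₁ ω ∧ (π ω).map Prod.snd = κ₂ ω ∧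
      ∫⁻ z, edist z.1 z.2 ^ p ∂(π ω) < R' ^ p := by
  have hp0 : 0 < p := by linarith
  obtain ⟨δ, hδ0, hδ⟩ : ∃ δ : ℝ≥0∞, 0 < δ ∧ R + 4 * δ < R' := by
    have ht : Tendsto (fun δ : ℝ≥0∞ => R + 4 * δ) (𝓝[>] 0) (𝓝 R) := by
      have := (ENNReal.Tendsto.const_mul (a := (4 : ℝ≥0∞)) (tendsto_id (x := 𝓝 (0 : ℝ≥0∞)))
        (.inr (by simp))).const_add R
      simpa using this.mono_left nhdsWithin_le_nhds
    obtain ⟨δ, h1, h2⟩ := ((ht.eventually (gt_mem_nhds hR)).and self_mem_nhdsWithin).exists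
    exact ⟨δ, h2, h1⟩
  have : Nonempty X := ⟨x₀⟩
  obtain ⟨q, e, hq, he⟩ := exists_measurable_quantization (X := X) hδ0
  have hpow (x y : X) : edist x y ^ p ≤
      2 ^ (p - 1) * edist x x₀ ^ p + 2 ^ (p - 1) * edist y x₀ ^ p := by
    rw [← mul_add]
    refine le_trans ?_ (ENNReal.rpow_add_le_mul_rpow_add_rpow _ _ hp)
    gcongr
    exact edist_triangle_right x y x₀
  have htwo : (2 : ℝ≥0∞) ^ (p - 1) ≠ ∞ := by simp
  refine exists_kernel_coupling κ₁ κ₂ hq hq (c := fun z => edist z.1 z.2 ^ p) (by fun_prop)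
    fun ω => ?_
  obtain ⟨π, hπ1, hπ2, hπ⟩ := h ω
  have : IsProbabilityMeasure π := ⟨by
    rw [← Set.preimage_univ (f := Prod.fst), ← Measure.map_apply measurable_fst .univ, hπ1,
      measure_univ]⟩
  refine exists_isGoodWeight hπ1 hπ2 hq hq (by fun_prop)
    (φ := fun x => 2 ^ (p - 1) * edist x x₀ ^ p) (ψ := fun x => 2 ^ (p - 1) * edist x x₀ ^ p)
    (by fun_prop) (by fun_prop) hpow ?_ ?_
    (G := fun kl => (edist (e kl.1) (e kl.2) + 2 * δ) ^ p) (fun z => ?_) ?_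
  · rw [lintegral_const_mul _ (by fun_prop)]
    exact ENNReal.mul_ne_top htwo (h₁ ω)
  · rw [lintegral_const_mul _ (by fun_prop)]
    exact ENNReal.mul_ne_top htwo (h₂ ω)
  · gcongr
    calc edist z.1 z.2 ≤ edist z.1 (e (q z.1)) + edist (e (q z.1)) (e (q z.2))
          + edist (e (q z.2)) z.2 := edist_triangle4 _ _ _ _
      _ ≤ δ + edist (e (q z.1)) (e (q z.2)) + δ := by
          gcongr
          · exact he _
          · rw [edist_comm]; exact he _
      _ = _ := by ring
  · have hM := ENNReal.lintegral_Lp_add_le (μ := π) (f := fun z : X × X => edist z.1 z.2)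
      (g := fun _ => 4 * δ) (by fun_prop) (by fun_prop) hp
    have hG (z : X × X) : (edist (e (q z.1)) (e (q z.2)) + 2 * δ) ^ p ≤
        ((fun z : X × X => edist z.1 z.2) + fun _ : X × X => 4 * δ) z ^ p := by
      simp only [Pi.add_apply]
      refine ENNReal.rpow_le_rpow ?_ hp0.le
      calc _ ≤ (edist (e (q z.1)) z.1 + edist z.1 z.2 + edist z.2 (e (q z.2))) + 2 * δ := by
            gcongr; exact edist_triangle4 _ _ _ _
        _ ≤ (δ + edist z.1 z.2 + δ) + 2 * δ := by
            gcongr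
            · rw [edist_comm]; exact he _
            · exact he _
        _ = _ := by ring
    refine (lintegral_mono hG).trans_lt ?_
    rw [← ENNReal.rpow_lt_rpow_iff (z := 1 / p) (by positivity)]
    refine hM.trans_lt ?_
    rw [← ENNReal.rpow_mul, mul_one_div_cancel hp0.ne', ENNReal.rpow_one, lintegral_const,
      measure_univ, mul_one, ← ENNReal.rpow_mul, mul_one_div_cancel hp0.ne', ENNReal.rpow_one]
    refine lt_of_le_of_lt ?_ hδ
    gcongr
    calc _ ≤ (R ^ p) ^ (1 / p) := by gcongr
      _ = R := by rw [← ENNReal.rpow_mul, mul_one_div_cancel hp0.ne', ENNReal.rpow_one]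

end KernelCoupling

section WassersteinDist

lemma ofReal_dist_rpow {X : Type*} [PseudoMetricSpace X] {p : ℝ} (hp : 0 ≤ p) (x y : X) :
    ENNReal.ofReal (dist x y ^ p) = edist x y ^ p := by
  rw [edist_dist, ENNReal.ofReal_rpow_of_nonneg dist_nonneg hp]

lemma lintegral_edist_rpow_ne_top {X : Type*} [PseudoMetricSpace X] [MeasurableSpace X]
    [OpensMeasurableSpace X] {p : ℝ} {μ ν : Measure X} (hp : 1 ≤ p) (x₀ : X) (π : Measure (X × X))
    (hπ₁ : π.map Prod.fst = μ) (hπ₂ : π.map Prod.snd = ν)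
    (hμ : ∫⁻ x, edist x x₀ ^ p ∂μ ≠ ∞) (hν : ∫⁻ x, edist x x₀ ^ p ∂ν ≠ ∞) :
    ∫⁻ z, edist z.1 z.2 ^ p ∂π ≠ ∞ := by
  have hle (z : X × X) : edist z.1 z.2 ^ p ≤
      2 ^ (p - 1) * (edist z.1 x₀ ^ p + edist z.2 x₀ ^ p) := by
    refine le_trans ?_ (ENNReal.rpow_add_le_mul_rpow_add_rpow _ _ hp)
    exact ENNReal.rpow_le_rpow (edist_triangle_right _ _ _) (by linarith)
  refine ((lintegral_mono hle).trans_lt ?_).ne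
  rw [lintegral_const_mul _ (by fun_prop), lintegral_add_left (by fun_prop)]
  rw [← hπ₁, lintegral_map (by fun_prop) measurable_fst] at hμ
  rw [← hπ₂, lintegral_map (by fun_prop) measurable_snd] at hν
  exact ENNReal.mul_lt_top
    (ENNReal.rpow_lt_top_of_nonneg (by linarith) (by simp))
    (ENNReal.add_lt_top.2 ⟨hμ.lt_top, hν.lt_top⟩)

variable {X : Type*} [PseudoMetricSpace X] [SecondCountableTopology X] [MeasurableSpace X]
  [BorelSpace X] {p : ℝ} {μ ν : Measure X}

lemma integral_dist_rpow_eq_toReal (hp : 0 ≤ p) (π : Measure (X × X)) :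
    ∫ z : X × X, dist z.1 z.2 ^ p ∂π = (∫⁻ z : X × X, edist z.1 z.2 ^ p ∂π).toReal := by
  rw [integral_eq_lintegral_of_nonneg_ae (ae_of_all _ fun z => by positivity)
    (Measurable.aestronglyMeasurable (by fun_prop))]
  simp only [ofReal_dist_rpow hp]

lemma wassersteinDist_le_of_coupling (hp : 1 ≤ p) {r : ℝ} (hr : 0 ≤ r) (π : Measure (X × X))
    (hπ₁ : π.map Prod.fst = μ) (hπ₂ : π.map Prod.snd = ν)
    (hπ : ∫⁻ z, edist z.1 z.2 ^ p ∂π ≤ ENNReal.ofReal r ^ p) :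
    wassersteinDist p μ ν ≤ r := by
  have hp0 : 0 < p := by linarith
  have hcost : (∫ z : X × X, dist z.1 z.2 ^ p ∂π) ^ (1 / p) ≤ r := by
    rw [integral_dist_rpow_eq_toReal hp0.le, one_div,
      Real.rpow_inv_le_iff_of_pos (by positivity) hr hp0]
    rw [ENNReal.ofReal_rpow_of_nonneg hr hp0.le] at hπ
    exact ENNReal.toReal_le_of_le_ofReal (by positivity) hπ
  refine le_trans (csInf_le ⟨0, ?_⟩ (by exact ⟨π, hπ₁, hπ₂, rfl⟩)) hcost
  rintro _ ⟨π', -, -, rfl⟩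
  positivity

lemma exists_coupling_of_wassersteinDist_lt [IsProbabilityMeasure μ] [IsProbabilityMeasure ν]
    (hp : 1 ≤ p) (x₀ : X) (hμ : ∫⁻ x, edist x x₀ ^ p ∂μ ≠ ∞) (hν : ∫⁻ x, edist x x₀ ^ p ∂ν ≠ ∞)
    {r : ℝ} (h : wassersteinDist p μ ν < r) :
    ∃ π : Measure (X × X), π.map Prod.fst = μ ∧ π.map Prod.snd = ν ∧
      ∫⁻ z, edist z.1 z.2 ^ p ∂π ≤ ENNReal.ofReal r ^ p := by
  have hp0 : 0 < p := by linarith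
  rw [wassersteinDist] at h
  obtain ⟨_, ⟨π, hπ₁, hπ₂, rfl⟩, hlt⟩ := exists_lt_of_csInf_lt
    (Set.nonempty_of_mem (Set.mem_ofPred.2 ⟨μ.prod ν, by simp, by simp, rfl⟩)) h
  refine ⟨π, hπ₁, hπ₂, ?_⟩
  rw [integral_dist_rpow_eq_toReal hp0.le] at hlt
  have hr : 0 ≤ r := le_trans (by positivity) hlt.le
  rw [one_div, Real.rpow_inv_lt_iff_of_pos (by positivity) hr hp0] at hlt
  rw [ENNReal.ofReal_rpow_of_nonneg hr hp0.le]
  exact (ENNReal.le_ofReal_iff_toReal_le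
    (lintegral_edist_rpow_ne_top hp x₀ π hπ₁ hπ₂ hμ hν) (by positivity)).2 hlt.le

end WassersteinDist

section Mixture

open ProbabilityTheory

variable {Ω X Y : Type*} [MeasurableSpace Ω] [MeasurableSpace X] [MeasurableSpace Y]

lemma measurable_kernel_map (κ : Kernel Ω X) [IsSFiniteKernel κ] {F : Ω → X → Y}
    (hF : Measurable (Function.uncurry F)) : Measurable fun ω => (κ ω).map (F ω) := by
  refine Measure.measurable_of_measurable_coe _ fun s hs => ?_
  have hpre (ω : Ω) : (κ ω).map (F ω) s = κ ω (Prod.mk ω ⁻¹' (Function.uncurry F ⁻¹' s)) :=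
    Measure.map_apply (hF.comp (measurable_prodMk_left (x := ω))) hs
  simp_rw [hpre]
  exact Kernel.measurable_kernel_prodMk_left (κ := κ) (hF hs)

lemma lintegral_bind_kernel_map (ρ : Measure Ω) (κ : Kernel Ω X) [IsSFiniteKernel κ]
    {F : Ω → X → Y} (hF : Measurable (Function.uncurry F)) {f : Y → ℝ≥0∞} (hf : Measurable f) :
    ∫⁻ y, f y ∂(ρ.bind fun ω => (κ ω).map (F ω)) = ∫⁻ ω, ∫⁻ x, f (F ω x) ∂(κ ω) ∂ρ := by
  rw [Measure.lintegral_bind (measurable_kernel_map κ hF).aemeasurable hf.aemeasurable]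
  exact lintegral_congr fun ω => lintegral_map hf (hF.comp (measurable_prodMk_left (x := ω)))

lemma map_bind_kernel_map {Z : Type*} [MeasurableSpace Z] (ρ : Measure Ω) (κ : Kernel Ω X)
    [IsSFiniteKernel κ] {F : Ω → X → Y} (hF : Measurable (Function.uncurry F)) {f : Y → Z}
    (hf : Measurable f) :
    (ρ.bind fun ω => (κ ω).map (F ω)).map f = ρ.bind fun ω => (κ ω).map fun x => f (F ω x) := by
  ext s hs
  have hfF : Measurable (Function.uncurry fun ω x => f (F ω x)) := hf.comp hF
  rw [Measure.map_apply hf hs, Measure.bind_apply (hf hs) (measurable_kernel_map κ hF).aemeasurable,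
    Measure.bind_apply hs (measurable_kernel_map κ hfF).aemeasurable]
  refine lintegral_congr fun ω => ?_
  have hFω : Measurable (F ω) := hF.comp measurable_prodMk_left
  rw [Measure.map_apply hFω (hf hs)]
  exact (Measure.map_apply (hf.comp hFω) hs).symm

/-- Mixtures of `L`-Lipschitz pushforwards scale the Wasserstein distance by at most `L`. -/
lemma wassersteinDist_bind_map_le [PseudoMetricSpace X] [SecondCountableTopology X] [BorelSpace X]
    [PseudoMetricSpace Y] [SecondCountableTopology Y] [BorelSpace Y]
    {p : ℝ} (hp : 1 ≤ p) (x₀ : X) (ρ : Measure Ω) [IsProbabilityMeasure ρ]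
    (κ₁ κ₂ : Kernel Ω X) [IsMarkovKernel κ₁] [IsMarkovKernel κ₂]
    (h₁ : ∀ ω, ∫⁻ x, edist x x₀ ^ p ∂(κ₁ ω) ≠ ∞) (h₂ : ∀ ω, ∫⁻ x, edist x x₀ ^ p ∂(κ₂ ω) ≠ ∞)
    {F : Ω → X → Y} (hF : Measurable (Function.uncurry F)) {L : ℝ} (hL : 0 ≤ L)
    (hFL : ∀ ω x y, edist (F ω x) (F ω y) ≤ ENNReal.ofReal L * edist x y)
    {M : ℝ} (hM : 0 ≤ M) (hW : ∀ ω, wassersteinDist p (κ₁ ω) (κ₂ ω) ≤ M) :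
    wassersteinDist p (ρ.bind fun ω => (κ₁ ω).map (F ω)) (ρ.bind fun ω => (κ₂ ω).map (F ω)) ≤
      L * M := by
  have hp0 : 0 < p := by linarith
  suffices h : ∀ r > M, wassersteinDist p (ρ.bind fun ω => (κ₁ ω).map (F ω))
      (ρ.bind fun ω => (κ₂ ω).map (F ω)) ≤ L * r by
    exact ge_of_tendsto
      (((continuous_const_mul L).tendsto M).mono_left (nhdsWithin_le_nhds (s := Set.Ioi M)))
      (eventually_mem_nhdsWithin.mono h)
  intro r hr
  obtain ⟨r', hMr', hr'⟩ := exists_between hr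
  obtain ⟨π, hπ⟩ := exists_kernel_coupling_edist hp x₀ κ₁ κ₂ h₁ h₂
    (R := ENNReal.ofReal r') (R' := ENNReal.ofReal r)
    ((ENNReal.ofReal_lt_ofReal_iff (by linarith)).2 hr')
    fun ω => exists_coupling_of_wassersteinDist_lt hp x₀ (h₁ ω) (h₂ ω) ((hW ω).trans_lt hMr')
  have : IsMarkovKernel π := ⟨fun ω => ⟨by
    rw [← Set.preimage_univ (f := Prod.fst), ← Measure.map_apply measurable_fst .univ, (hπ ω).1,
      measure_univ]⟩⟩
  have hFF : Measurable (Function.uncurry fun ω (z : X × X) => (F ω z.1, F ω z.2)) := by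
    refine Measurable.prodMk (hF.comp (f := fun q : Ω × X × X => (q.1, q.2.1)) ?_)
      (hF.comp (f := fun q : Ω × X × X => (q.1, q.2.2)) ?_) <;> fun_prop
  have hFω (ω : Ω) : Measurable (F ω) := hF.comp measurable_prodMk_left
  refine wassersteinDist_le_of_coupling hp (by nlinarith)
    (ρ.bind fun ω => (π ω).map fun z => (F ω z.1, F ω z.2)) ?_ ?_ ?_
  · rw [map_bind_kernel_map ρ π hFF measurable_fst]
    congr 1 with ω : 1
    rw [← (hπ ω).1, Measure.map_map (hFω ω) measurable_fst]
    rfl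
  · rw [map_bind_kernel_map ρ π hFF measurable_snd]
    congr 1 with ω : 1
    rw [← (hπ ω).2.1, Measure.map_map (hFω ω) measurable_snd]
    rfl
  · rw [lintegral_bind_kernel_map ρ π hFF (by fun_prop)]
    calc ∫⁻ ω, ∫⁻ z, edist (F ω z.1) (F ω z.2) ^ p ∂(π ω) ∂ρ
        ≤ ∫⁻ _, (ENNReal.ofReal (L * r)) ^ p ∂ρ := lintegral_mono fun ω => by
          calc ∫⁻ z, edist (F ω z.1) (F ω z.2) ^ p ∂(π ω)
              ≤ ∫⁻ z, ENNReal.ofReal L ^ p * edist z.1 z.2 ^ p ∂(π ω) :=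
                lintegral_mono fun z => by
                  rw [← ENNReal.mul_rpow_of_nonneg _ _ hp0.le]
                  exact ENNReal.rpow_le_rpow (hFL ω z.1 z.2) hp0.le
            _ ≤ ENNReal.ofReal L ^ p * ENNReal.ofReal r ^ p := by
                rw [lintegral_const_mul _ (by fun_prop)]
                gcongr
                exact (hπ ω).2.2.le
            _ = _ := by rw [ENNReal.ofReal_mul hL, ENNReal.mul_rpow_of_nonneg _ _ hp0.le]
      _ = _ := by simp

end Mixture

section AffineMap

lemma measurable_add_toEuclideanLin {Ω : Type*} [MeasurableSpace Ω] {d : ℕ}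
    {b : Ω → EuclideanSpace ℝ (Fin d)} (hb : Measurable b)
    {A : Ω → Matrix (Fin d) (Fin d) ℝ} (hA : ∀ i j, Measurable fun ω => A ω i j) :
    Measurable (Function.uncurry fun ω x => b ω + Matrix.toEuclideanLin (A ω) x) := by
  refine (hb.comp measurable_fst).add ?_
  refine (WithLp.measurable_toLp 2 _).comp (measurable_pi_lambda _ fun i => ?_)
  change Measurable fun q : Ω × EuclideanSpace ℝ (Fin d) => ∑ j, A q.1 i j * q.2 j
  refine Finset.measurable_sum _ fun j _ => ((hA i j).comp measurable_fst).mul ?_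
  fun_prop

lemma edist_add_toEuclideanLin_le {m n : Type*} [Fintype m] [Fintype n] [DecidableEq n]
    (A : Matrix m n ℝ) {K : ℝ} (hK : specNorm A ≤ K) (b : EuclideanSpace ℝ m)
    (x y : EuclideanSpace ℝ n) :
    edist (b + Matrix.toEuclideanLin A x) (b + Matrix.toEuclideanLin A y) ≤
      ENNReal.ofReal K * edist x y := by
  have hK0 : 0 ≤ K := (norm_nonneg _).trans hK
  rw [edist_add_left, edist_dist, edist_dist, ← ENNReal.ofReal_mul hK0, dist_eq_norm, dist_eq_norm,
    ← map_sub]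
  refine ENNReal.ofReal_le_ofReal ?_
  exact (LinearMap.toContinuousLinearMap (Matrix.toEuclideanLin A)).le_of_opNorm_le hK (x - y)

end AffineMap

/-- The mixture-of-affine-pushforwards operator `T` is a contraction in the
supremum-`p`-Wasserstein metric, with coefficient `K = sup ‖A‖_op`. -/
theorem sup_wasserstein_contraction_affineMixtureOp
    {S : Type*} [MeasurableSpace S] {d : ℕ} {Ω : Type*} [MeasurableSpace Ω]
    (ρ : Measure Ω) [IsProbabilityMeasure ρ]
    (p : ℝ) (hp : 1 ≤ p)
    (g : S × Ω → S) (hg : Measurable g)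
    (b : S × Ω → EuclideanSpace ℝ (Fin d)) (hb : Measurable b)
    (A : S × Ω → Matrix (Fin d) (Fin d) ℝ) (hA : ∀ i j, Measurable fun q => A q i j)
    (K : ℝ) (hK0 : 0 ≤ K) (hK : ∀ q, specNorm (A q) ≤ K)
    (η₁ η₂ : S → Measure (EuclideanSpace ℝ (Fin d)))
    (hη₁ : Measurable η₁) (hη₂ : Measurable η₂)
    (hprob₁ : ∀ s, IsProbabilityMeasure (η₁ s)) (hprob₂ : ∀ s, IsProbabilityMeasure (η₂ s))
    (hmom₁ : ∀ s, Integrable (fun x => ‖x‖ ^ p) (η₁ s))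
    (hmom₂ : ∀ s, Integrable (fun x => ‖x‖ ^ p) (η₂ s))
    (hbdd : BddAbove (Set.range fun s => wassersteinDist p (η₁ s) (η₂ s))) :
    (⨆ s, wassersteinDist p (affineMixtureOp ρ g b A η₁ s) (affineMixtureOp ρ g b A η₂ s)) ≤
      K * ⨆ s, wassersteinDist p (η₁ s) (η₂ s) := by
  have hp0 : 0 ≤ p := by linarith
  have hmom {η : S → Measure (EuclideanSpace ℝ (Fin d))}
      (h : ∀ s, Integrable (fun x => ‖x‖ ^ p) (η s)) (s : S) :
      ∫⁻ x, edist x 0 ^ p ∂(η s) ≠ ⊤ := by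
    simpa only [← ofReal_dist_rpow hp0, dist_zero_right] using
      ((h s).lintegral_lt_top).ne
  have hnonneg : 0 ≤ ⨆ s, wassersteinDist p (η₁ s) (η₂ s) :=
    Real.iSup_nonneg fun s => Real.sInf_nonneg <| by
      rintro _ ⟨π, -, -, rfl⟩
      positivity
  refine Real.iSup_le (fun s => ?_) (mul_nonneg hK0 hnonneg)
  have hgs : Measurable fun ω => g (s, ω) := hg.comp measurable_prodMk_left
  let κ₁ : ProbabilityTheory.Kernel Ω (EuclideanSpace ℝ (Fin d)) :=
    ⟨fun ω => η₁ (g (s, ω)), hη₁.comp hgs⟩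
  let κ₂ : ProbabilityTheory.Kernel Ω (EuclideanSpace ℝ (Fin d)) :=
    ⟨fun ω => η₂ (g (s, ω)), hη₂.comp hgs⟩
  have : ProbabilityTheory.IsMarkovKernel κ₁ := ⟨fun ω => hprob₁ (g (s, ω))⟩
  have : ProbabilityTheory.IsMarkovKernel κ₂ := ⟨fun ω => hprob₂ (g (s, ω))⟩
  have hF : Measurable (Function.uncurry fun ω x =>
      b (s, ω) + Matrix.toEuclideanLin (A (s, ω)) x) :=
    measurable_add_toEuclideanLin (hb.comp measurable_prodMk_left)
      fun i j => (hA i j).comp measurable_prodMk_left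
  have hW (ω : Ω) : wassersteinDist p (κ₁ ω) (κ₂ ω) ≤ ⨆ s, wassersteinDist p (η₁ s) (η₂ s) :=
    le_ciSup hbdd (g (s, ω))
  exact wassersteinDist_bind_map_le hp 0 ρ κ₁ κ₂ (fun ω => hmom hmom₁ (g (s, ω)))
    (fun ω => hmom hmom₂ (g (s, ω))) hF hK0
    (fun ω => edist_add_toEuclideanLin_le (A (s, ω)) (hK (s, ω)) (b (s, ω))) hnonneg hW
end

section
/- Let h > 0 and let k_h(x,y) = −√(1 + h²‖x−y‖²) be the multiquadric kernel on ℝ^d. For s ∈ [0,1] let S_s : ℝ^d → ℝ^d be the scaling map S_s(x) = s·x. Then for all probability measures μ, ν on ℝ^d with finite second moments, MMD²_{k_h}((S_s)_#μ, (S_s)_#ν) ≤ s · MMD²_{k_h}(μ, ν); consequently MMD_{k_h}((S_s)_#μ, (S_s)_#ν) ≤ √s · MMD_{k_h}(μ, ν). -/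
open MeasureTheory

/-- The squared maximum mean discrepancy between `P` and `Q` with respect to a kernel `k`:
`MMD²_k(P,Q) = ∬ k dP dP + ∬ k dQ dQ − 2 ∬ k dP dQ`. -/
noncomputable def mmdSq {E : Type*} [MeasurableSpace E] (k : E → E → ℝ)
    (P Q : Measure E) : ℝ :=
  (∫ x, ∫ y, k x y ∂P ∂P) + (∫ x, ∫ y, k x y ∂Q ∂Q) - 2 * ∫ x, ∫ y, k x y ∂P ∂Q

/-- The multiquadric kernel with bandwidth `h`: `k_h(x,y) = −√(1 + h²‖x−y‖²)`. -/
noncomputable def multiquadric {d : ℕ} (h : ℝ) (x y : EuclideanSpace ℝ (Fin d)) : ℝ :=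
  -Real.sqrt (1 + h ^ 2 * ‖x - y‖ ^ 2)

section Mmd

variable {E : Type*} [MeasurableSpace E]

theorem mmdSq_const_mul (c : ℝ) (k : E → E → ℝ) (P Q : Measure E) :
    mmdSq (fun x y => c * k x y) P Q = c * mmdSq k P Q := by
  simp only [mmdSq, integral_const_mul]
  ring

theorem mmdSq_rankOne (f : E → ℝ) (P Q : Measure E) :
    mmdSq (fun x y => f x * f y) P Q = (∫ x, f x ∂P - ∫ x, f x ∂Q) ^ 2 := by
  simp only [mmdSq, integral_const_mul, integral_mul_const]
  ring

theorem mmdSq_sub {k l : E → E → ℝ} {P Q : Measure E} [SFinite P] [SFinite Q]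
    (hkP : Integrable (Function.uncurry k) (P.prod P))
    (hkQ : Integrable (Function.uncurry k) (Q.prod Q))
    (hkQP : Integrable (Function.uncurry k) (Q.prod P))
    (hlP : Integrable (Function.uncurry l) (P.prod P))
    (hlQ : Integrable (Function.uncurry l) (Q.prod Q))
    (hlQP : Integrable (Function.uncurry l) (Q.prod P)) :
    mmdSq (fun x y => k x y - l x y) P Q = mmdSq k P Q - mmdSq l P Q := by
  have key : ∀ (μ' ν' : Measure E) [SFinite μ'] [SFinite ν'],
      Integrable (Function.uncurry k) (μ'.prod ν') → Integrable (Function.uncurry l) (μ'.prod ν') →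
      ∫ x, ∫ y, (k x y - l x y) ∂ν' ∂μ' = ∫ x, ∫ y, k x y ∂ν' ∂μ' - ∫ x, ∫ y, l x y ∂ν' ∂μ' := by
    intro μ' ν' _ _ hk hl
    exact integral_integral_sub hk hl
  simp only [mmdSq]
  rw [key P P hkP hlP, key Q Q hkQ hlQ, key Q P hkQP hlQP]
  ring

/-- A nonnegative kernel which is a bounded mixture of kernels with nonnegative squared
discrepancy has nonnegative squared discrepancy. -/
theorem mmdSq_nonneg_of_mixture {Ω : Type*} [MeasurableSpace Ω] {ρ : Measure Ω} [SFinite ρ]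
    {K : Ω → E → E → ℝ} {k : E → E → ℝ} {P Q : Measure E}
    [IsProbabilityMeasure P] [IsProbabilityMeasure Q] {C : ℝ}
    (hKm : Measurable fun p : Ω × E × E => K p.1 p.2.1 p.2.2)
    (hK0 : ∀ ω x y, 0 ≤ K ω x y)
    (hKi : ∀ x y, Integrable (fun ω => K ω x y) ρ)
    (hk : ∀ x y, ∫ ω, K ω x y ∂ρ = k x y)
    (hC : ∀ x y, k x y ≤ C)
    (hpos : ∀ᵐ ω ∂ρ, 0 ≤ mmdSq (K ω) P Q) :
    0 ≤ mmdSq k P Q := by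
  have hint : ∀ (μ' ν' : Measure E) [IsProbabilityMeasure μ'] [IsProbabilityMeasure ν'],
      Integrable (fun p : Ω × E × E => K p.1 p.2.1 p.2.2) (ρ.prod (μ'.prod ν')) := by
    intro μ' ν' _ _
    rw [integrable_prod_iff' hKm.aestronglyMeasurable]
    refine ⟨.of_forall fun p => hKi p.1 p.2, ?_⟩
    refine Integrable.of_bound (C := C) ?_ (.of_forall fun p => ?_)
    · exact (hKm.norm.comp
        measurable_swap).stronglyMeasurable.integral_prod_right'.aestronglyMeasurable
    · simp only [Real.norm_of_nonneg (hK0 _ _ _), hk]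
      rw [Real.norm_of_nonneg]
      · exact hC _ _
      · rw [← hk]
        exact integral_nonneg fun ω => hK0 _ _ _
  have key : ∀ (μ' ν' : Measure E) [IsProbabilityMeasure μ'] [IsProbabilityMeasure ν'],
      Integrable (fun ω => ∫ x, ∫ y, K ω x y ∂ν' ∂μ') ρ ∧
        ∫ x, ∫ y, k x y ∂ν' ∂μ' = ∫ ω, ∫ x, ∫ y, K ω x y ∂ν' ∂μ' ∂ρ := by
    intro μ' ν' _ _
    have hae : (fun ω => ∫ p : E × E, K ω p.1 p.2 ∂μ'.prod ν') =ᵐ[ρ]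
        fun ω => ∫ x, ∫ y, K ω x y ∂ν' ∂μ' := by
      filter_upwards [(hint μ' ν').prod_right_ae] with ω hω
      exact integral_prod _ hω
    refine ⟨(hint μ' ν').integral_prod_left.congr hae, ?_⟩
    rw [← integral_congr_ae hae,
      integral_integral_swap (f := fun ω (p : E × E) => K ω p.1 p.2) (hint μ' ν')]
    simp only [hk]
    rw [integral_prod (fun p : E × E => k p.1 p.2)]
    have := (hint μ' ν').integral_prod_right
    simpa only [hk] using this
  have h1 := key P P
  have h2 := key Q Q
  have h3 := key Q P
  have : mmdSq k P Q = ∫ ω, mmdSq (K ω) P Q ∂ρ := by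
    simp only [mmdSq]
    rw [h1.2, h2.2, h3.2, ← integral_const_mul, ← integral_add h1.1 h2.1,
      ← integral_sub (by exact h1.1.add h2.1) (h3.1.const_mul 2)]
  rw [this]
  exact integral_nonneg_of_ae hpos

end Mmd

section Euclidean

variable {E : Type*} [NormedAddCommGroup E] [InnerProductSpace ℝ E]

theorem exp_mul_exp_eq_midpoint (c : ℝ) (x y z : E) :
    Real.exp (-(2 * c) * ‖x - z‖ ^ 2) * Real.exp (-(2 * c) * ‖y - z‖ ^ 2) =
      Real.exp (-(c * ‖x - y‖ ^ 2)) *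
        Real.exp (-(4 * c) * ‖z - (2⁻¹ : ℝ) • (x + y)‖ ^ 2) := by
  rw [← Real.exp_add, ← Real.exp_add]
  congr 1
  have h1 := parallelogram_law_with_norm ℝ (x - z) (y - z)
  have h2 : ‖x - z + (y - z)‖ = 2 * ‖z - (2⁻¹ : ℝ) • (x + y)‖ := by
    have : x - z + (y - z) = (-2 : ℝ) • (z - (2⁻¹ : ℝ) • (x + y)) := by module
    rw [this, norm_smul]
    norm_num
  have h3 : x - z - (y - z) = x - y := by abel
  rw [h2, h3] at h1
  linear_combination c * h1

variable [FiniteDimensional ℝ E] [MeasurableSpace E] [BorelSpace E]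

theorem integrable_exp_neg_mul_sq_norm {c : ℝ} (hc : 0 < c) :
    Integrable (fun z : E => Real.exp (-c * ‖z‖ ^ 2)) := by
  by_contra hn
  have h1 := GaussianFourier.integral_rexp_neg_mul_sq_norm (V := E) hc
  rw [integral_undef hn] at h1
  have : 0 < (Real.pi / c) ^ (Module.finrank ℝ E / 2 : ℝ) := by positivity
  exact this.ne h1

variable {P Q : Measure E} [IsProbabilityMeasure P] [IsProbabilityMeasure Q]

theorem mmdSq_gaussian_nonneg {c : ℝ} (hc : 0 ≤ c) :
    0 ≤ mmdSq (fun x y : E => Real.exp (-(c * ‖x - y‖ ^ 2))) P Q := by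
  rcases hc.eq_or_lt with rfl | hc
  · simp [mmdSq]
    norm_num
  set M : ℝ := ∫ z : E, Real.exp (-(4 * c) * ‖z‖ ^ 2) with hM
  have hMpos : 0 < M := by
    rw [hM, GaussianFourier.integral_rexp_neg_mul_sq_norm (by positivity)]
    positivity
  refine mmdSq_nonneg_of_mixture (ρ := (volume : Measure E)) (C := 1)
    (K := fun z x y => M⁻¹ * (Real.exp (-(2 * c) * ‖x - z‖ ^ 2) *
      Real.exp (-(2 * c) * ‖y - z‖ ^ 2))) ?_ ?_ ?_ ?_ ?_ ?_
  · fun_prop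
  · intro z x y
    positivity
  · intro x y
    simp only [exp_mul_exp_eq_midpoint]
    exact (((integrable_exp_neg_mul_sq_norm (by positivity)).comp_sub_right _).const_mul
      _).const_mul _
  · intro x y
    simp only [exp_mul_exp_eq_midpoint, integral_const_mul]
    rw [integral_sub_right_eq_self (fun z : E => Real.exp (-(4 * c) * ‖z‖ ^ 2)), ← hM]
    field_simp
  · intro x y
    exact Real.exp_le_one_iff.2 (neg_nonpos.2 (by positivity))
  · refine .of_forall fun z => ?_
    rw [mmdSq_const_mul, mmdSq_rankOne]
    positivity

theorem mmdSq_inverse_multiquadric_nonneg {a w : ℝ} (ha : 0 < a) (hw : 0 ≤ w) :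
    0 ≤ mmdSq (fun x y : E => √(Real.pi / (a + w * ‖x - y‖ ^ 2))) P Q := by
  have hpos : ∀ x y : E, 0 < a + w * ‖x - y‖ ^ 2 := fun x y => by positivity
  refine mmdSq_nonneg_of_mixture (ρ := (volume : Measure ℝ)) (C := √(Real.pi / a))
    (K := fun t x y => Real.exp (-(a + w * ‖x - y‖ ^ 2) * t ^ 2)) ?_ ?_ ?_ ?_ ?_ ?_
  · fun_prop
  · intro t x y
    positivity
  · intro x y
    exact integrable_exp_neg_mul_sq (hpos x y)
  · intro x y
    exact integral_gaussian _
  · intro x y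
    gcongr
    exact le_add_of_nonneg_right (by positivity)
  · refine .of_forall fun t => ?_
    have : (fun x y : E => Real.exp (-(a + w * ‖x - y‖ ^ 2) * t ^ 2)) =
        fun x y => Real.exp (-a * t ^ 2) * Real.exp (-((w * t ^ 2) * ‖x - y‖ ^ 2)) := by
      ext x y
      rw [← Real.exp_add]
      ring_nf
    rw [this, mmdSq_const_mul]
    exact mul_nonneg (Real.exp_pos _).le (mmdSq_gaussian_nonneg (by positivity))

theorem hasDerivAt_sqrt_add_const {a v : ℝ} (h : 0 < a + v) :
    HasDerivAt (fun a => √(a + v)) ((2 * √Real.pi)⁻¹ * √(Real.pi / (a + v))) a := by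
  refine (((hasDerivAt_id a).add_const v).sqrt h.ne').congr_deriv ?_
  rw [Real.sqrt_div Real.pi_pos.le]
  have := Real.sqrt_pos.2 h
  have := Real.sqrt_pos.2 Real.pi_pos
  simp only [id]
  field_simp

theorem integrableOn_deriv_sqrt_add {r v : ℝ} (hr0 : 0 ≤ r) (hv : 0 ≤ v) :
    IntegrableOn (fun a => (2 * √Real.pi)⁻¹ * √(Real.pi / (a + v))) (Set.Ioc r 1) := by
  refine intervalIntegral.integrableOn_deriv_of_nonneg (g := fun a => √(a + v))
    (by fun_prop) (fun a ha => hasDerivAt_sqrt_add_const ?_) fun a ha => by positivity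
  linarith [ha.1]

theorem integral_deriv_sqrt_add {r v : ℝ} (hr0 : 0 ≤ r) (hr1 : r ≤ 1) (hv : 0 ≤ v) :
    ∫ a in Set.Ioc r 1, (2 * √Real.pi)⁻¹ * √(Real.pi / (a + v)) = √(1 + v) - √(r + v) := by
  rw [← intervalIntegral.integral_of_le hr1]
  refine intervalIntegral.integral_eq_sub_of_hasDerivAt_of_le (f := fun a => √(a + v)) hr1
    (by fun_prop) (fun a ha => hasDerivAt_sqrt_add_const ?_) ?_
  · linarith [ha.1]
  · exact (intervalIntegrable_iff_integrableOn_Ioc_of_le hr1).2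
      (integrableOn_deriv_sqrt_add hr0 hv)

theorem mmdSq_sqrt_sub_sqrt_nonneg {r w : ℝ} (hr0 : 0 ≤ r) (hr1 : r ≤ 1) (hw : 0 ≤ w) :
    0 ≤ mmdSq (fun x y : E => √(1 + w * ‖x - y‖ ^ 2) - √(r + w * ‖x - y‖ ^ 2)) P Q := by
  refine mmdSq_nonneg_of_mixture (ρ := (volume : Measure ℝ).restrict (Set.Ioc r 1)) (C := 1)
    (K := fun a x y => (2 * √Real.pi)⁻¹ * √(Real.pi / (a + w * ‖x - y‖ ^ 2))) ?_ ?_ ?_ ?_ ?_ ?_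
  · fun_prop
  · intro a x y
    positivity
  · intro x y
    exact integrableOn_deriv_sqrt_add hr0 (by positivity)
  · intro x y
    exact integral_deriv_sqrt_add hr0 hr1 (by positivity)
  · intro x y
    have h0 : 0 ≤ w * ‖x - y‖ ^ 2 := by positivity
    have h1 : √(1 + w * ‖x - y‖ ^ 2) ≤ 1 + √(w * ‖x - y‖ ^ 2) := by
      refine Real.sqrt_le_iff.2 ⟨by positivity, ?_⟩
      nlinarith [Real.sq_sqrt h0, Real.sqrt_nonneg (w * ‖x - y‖ ^ 2)]
    have h2 : √(w * ‖x - y‖ ^ 2) ≤ √(r + w * ‖x - y‖ ^ 2) :=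
      Real.sqrt_le_sqrt (le_add_of_nonneg_left hr0)
    linarith
  · filter_upwards [ae_restrict_mem measurableSet_Ioc] with a ha
    rw [mmdSq_const_mul]
    exact mul_nonneg (by positivity)
      (mmdSq_inverse_multiquadric_nonneg (hr0.trans_lt ha.1) hw)

end Euclidean

section Multiquadric

variable {d : ℕ}

theorem measurable_multiquadric (h : ℝ) :
    Measurable (Function.uncurry (multiquadric (d := d) h)) := by
  unfold multiquadric Function.uncurry
  fun_prop

theorem integrable_multiquadric (h : ℝ) {μ ν : Measure (EuclideanSpace ℝ (Fin d))}
    [IsProbabilityMeasure μ] [IsProbabilityMeasure ν]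
    (hμ : Integrable (fun x => ‖x‖ ^ 2) μ) (hν : Integrable (fun x => ‖x‖ ^ 2) ν) :
    Integrable (Function.uncurry (multiquadric h)) (μ.prod ν) := by
  have hb := ((integrable_const (1 : ℝ)).add
    (((hμ.comp_fst ν).add (hν.comp_snd μ)).const_mul (2 * h ^ 2)))
  refine hb.mono' (measurable_multiquadric h).aestronglyMeasurable (.of_forall fun p => ?_)
  obtain ⟨x, y⟩ := p
  have h1 := parallelogram_law_with_norm ℝ x y
  have h2 : h ^ 2 * ‖x - y‖ ^ 2 ≤ 2 * h ^ 2 * (‖x‖ ^ 2 + ‖y‖ ^ 2) := by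
    nlinarith [mul_nonneg (sq_nonneg h) (sq_nonneg ‖x + y‖)]
  have h3 : 0 ≤ h ^ 2 * ‖x - y‖ ^ 2 := by positivity
  simp only [Function.uncurry, multiquadric, norm_neg, Pi.add_apply]
  rw [Real.norm_of_nonneg (Real.sqrt_nonneg _)]
  refine (Real.sqrt_le_iff.2 ⟨by positivity, ?_⟩ : _ ≤ 1 + h ^ 2 * ‖x - y‖ ^ 2).trans (by gcongr)
  nlinarith

theorem multiquadric_smul (h s : ℝ) (x y : EuclideanSpace ℝ (Fin d)) :
    multiquadric h (s • x) (s • y) = multiquadric (h * s) x y := by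
  simp only [multiquadric, ← smul_sub, norm_smul, mul_pow, Real.norm_eq_abs, sq_abs]
  ring_nf

theorem mmdSq_multiquadric_map_smul (h s : ℝ) (μ ν : Measure (EuclideanSpace ℝ (Fin d)))
    [IsProbabilityMeasure μ] [IsProbabilityMeasure ν] :
    mmdSq (multiquadric h) (μ.map fun x => s • x) (ν.map fun x => s • x) =
      mmdSq (multiquadric (h * s)) μ ν := by
  have hm : Measurable fun x : EuclideanSpace ℝ (Fin d) => s • x := by fun_prop
  have key : ∀ (μ' ν' : Measure (EuclideanSpace ℝ (Fin d))) [IsProbabilityMeasure ν'],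
      ∫ x, ∫ y, multiquadric h x y ∂(ν'.map fun x => s • x) ∂(μ'.map fun x => s • x) =
        ∫ x, ∫ y, multiquadric (h * s) x y ∂ν' ∂μ' := by
    intro μ' ν' _
    have := Measure.isProbabilityMeasure_map (μ := ν') hm.aemeasurable
    rw [integral_map hm.aemeasurable
      (measurable_multiquadric h).stronglyMeasurable.integral_prod_right.aestronglyMeasurable]
    congr 1
    ext x
    have hx : Measurable (multiquadric h (s • x)) :=
      (measurable_multiquadric h).of_uncurry_left
    rw [integral_map hm.aemeasurable hx.aestronglyMeasurable]
    simp only [multiquadric_smul]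
  simp only [mmdSq, key]

theorem mul_multiquadric_sub {s : ℝ} (hs : 0 ≤ s) (h : ℝ) (x y : EuclideanSpace ℝ (Fin d)) :
    s * multiquadric h x y - multiquadric (h * s) x y =
      √(1 + (h * s) ^ 2 * ‖x - y‖ ^ 2) - √(s ^ 2 + (h * s) ^ 2 * ‖x - y‖ ^ 2) := by
  have : √(s ^ 2 + (h * s) ^ 2 * ‖x - y‖ ^ 2) = s * √(1 + h ^ 2 * ‖x - y‖ ^ 2) := by
    rw [show s ^ 2 + (h * s) ^ 2 * ‖x - y‖ ^ 2 = s ^ 2 * (1 + h ^ 2 * ‖x - y‖ ^ 2) by ring,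
      Real.sqrt_mul (sq_nonneg s), Real.sqrt_sq hs]
  rw [this, multiquadric, multiquadric]
  ring

end Multiquadric

/-- Scale-contraction of the multiquadric-kernel MMD: for `s ∈ [0,1]` and
the scaling map `S_s(x) = s·x`,
`MMD²_{k_h}((S_s)_#μ, (S_s)_#ν) ≤ s · MMD²_{k_h}(μ, ν)`, and consequently
`MMD_{k_h}((S_s)_#μ, (S_s)_#ν) ≤ √s · MMD_{k_h}(μ, ν)`. -/
theorem mmd_multiquadric_scale_contraction {d : ℕ} (h : ℝ) (hh : 0 < h)
    (s : ℝ) (hs : s ∈ Set.Icc (0 : ℝ) 1)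
    (μ ν : Measure (EuclideanSpace ℝ (Fin d)))
    [IsProbabilityMeasure μ] [IsProbabilityMeasure ν]
    (hμ : Integrable (fun x => ‖x‖ ^ 2) μ) (hν : Integrable (fun x => ‖x‖ ^ 2) ν) :
    mmdSq (multiquadric h) (μ.map fun x => s • x) (ν.map fun x => s • x) ≤
        s * mmdSq (multiquadric h) μ ν ∧
      Real.sqrt (mmdSq (multiquadric h) (μ.map fun x => s • x) (ν.map fun x => s • x)) ≤
        Real.sqrt s * Real.sqrt (mmdSq (multiquadric h) μ ν) := by
  have hle : mmdSq (multiquadric h) (μ.map fun x => s • x) (ν.map fun x => s • x) ≤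
      s * mmdSq (multiquadric h) μ ν := by
    rw [mmdSq_multiquadric_map_smul, ← sub_nonneg, ← mmdSq_const_mul, ← mmdSq_sub
      ((integrable_multiquadric h hμ hμ).const_mul s)
      ((integrable_multiquadric h hν hν).const_mul s)
      ((integrable_multiquadric h hν hμ).const_mul s)
      (integrable_multiquadric _ hμ hμ) (integrable_multiquadric _ hν hν)
      (integrable_multiquadric _ hν hμ)]
    simp only [mul_multiquadric_sub hs.1]
    exact mmdSq_sqrt_sub_sqrt_nonneg (sq_nonneg s) (pow_le_one₀ hs.1 hs.2) (sq_nonneg _)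
  exact ⟨hle, (Real.sqrt_le_sqrt hle).trans_eq (Real.sqrt_mul hs.1 _)⟩
end
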